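/- For d = 9, the sign pattern Σ_{2,4,4} is not realizable with the pair (0, 7): there is no monic real polynomial of degree 9 whose coefficients of x^9, x^8 are positive, coefficients of x^7, x^6, x^5, x^4 are negative, coefficients of x^3, x^2, x^1, x^0 are positive, and which has exactly 7 distinct negative roots, all simple, and no other real roots. -/

import Mathlib

open Polynomial

/-- A real polynomial `P` realizes the pair `(pos, neg)` if it has exactly `pos`
distinct positive roots and exactly `neg` distinct negative roots, all of them
simple, and no other real roots. -/
def realizesPair (P : Polynomial ℝ) (pos neg : ℕ) : Prop :=
  P.roots.Nodup ∧
  (P.roots.filter (fun x => 0 < x)).card = pos ∧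
  (P.roots.filter (fun x => x < 0)).card = neg ∧
  (0 : ℝ) ∉ P.roots

theorem splits_derivative {f : ℝ[X]} (hf : f.Splits) : (derivative f).Splits := by
  rw [splits_iff_card_roots] at hf ⊢
  have h1 := card_roots_le_derivative f
  have h2 := card_roots' (derivative f)
  rw [natDegree_derivative] at h2 ⊢
  omega

theorem splits_reverse {f : ℝ[X]} (hf : f.Splits) : f.reverse.Splits := by
  induction hf using Submonoid.closure_induction with
  | mem x hx =>
    apply Splits.of_natDegree_le_one
    refine (reverse_natDegree_le x).trans ?_
    rcases hx with ⟨a, rfl⟩ | ⟨a, rfl⟩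
    · simp
    · simp
  | one =>
    rw [← C_1, reverse_C]
    exact Splits.C 1
  | mul x y _ _ hx hy =>
    rw [reverse_mul_of_domain]
    exact hx.mul hy

/-- Schur's inequality in degree one. -/
theorem schur_inequality {x y z : ℝ} (hx : 0 ≤ x) (hy : 0 ≤ y) (hz : 0 ≤ z) :
    (x + y + z) * (4 * (x * y + y * z + z * x) - (x + y + z) ^ 2) ≤ 9 * (x * y * z) := by
  rcases le_total x y with h | h <;> rcases le_total y z with h' | h' <;>
    rcases le_total x z with h'' | h'' <;>
    nlinarith [mul_nonneg (sub_nonneg.2 h) (sub_nonneg.2 h'),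
      mul_nonneg (sub_nonneg.2 h) (sub_nonneg.2 h''),
      mul_nonneg (sub_nonneg.2 h') (sub_nonneg.2 h''),
      mul_nonneg hx (sq_nonneg (x - y)), mul_nonneg hx (sq_nonneg (x - z)),
      mul_nonneg hy (sq_nonneg (x - y)), mul_nonneg hy (sq_nonneg (y - z)),
      mul_nonneg hz (sq_nonneg (x - z)), mul_nonneg hz (sq_nonneg (y - z)),
      mul_nonneg hx (mul_nonneg (sub_nonneg.2 h) (sub_nonneg.2 h'')),
      mul_nonneg hy (mul_nonneg (sub_nonneg.2 h) (sub_nonneg.2 h')),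
      mul_nonneg hz (mul_nonneg (sub_nonneg.2 h') (sub_nonneg.2 h'')),
      mul_nonneg (sub_nonneg.2 h) (sq_nonneg (x - y)),
      mul_nonneg (sub_nonneg.2 h') (sq_nonneg (y - z)),
      mul_nonneg (sub_nonneg.2 h'') (sq_nonneg (x - z))]

/-- The Newton and Schur inequalities for the coefficients of a real-rooted cubic with positive
coefficients, normalized by its constant term. -/
theorem cubic_coeff_inequalities {g : ℝ[X]} (hg : g.Splits) (hd : g.natDegree = 3)
    (hpos : ∀ k ≤ 3, 0 < g.coeff k) :
    3 * (g.coeff 2 / g.coeff 0) ≤ (g.coeff 1 / g.coeff 0) ^ 2 ∧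
    (g.coeff 1 / g.coeff 0) * (4 * (g.coeff 2 / g.coeff 0) - (g.coeff 1 / g.coeff 0) ^ 2) ≤
      9 * (g.coeff 3 / g.coeff 0) := by
  have hcard := hg.natDegree_eq_card_roots
  rw [hd, eq_comm, Multiset.card_eq_three] at hcard
  obtain ⟨x, y, z, hr⟩ := hcard
  have hneg : ∀ t ∈ g.roots, t < 0 := by
    intro t ht
    by_contra! h0
    have hev : g.eval t = 0 := (mem_roots'.1 ht).2
    rw [eval_eq_sum_range, hd] at hev
    simp only [Finset.sum_range_succ, Finset.sum_range_zero] at hev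
    have h1 := mul_nonneg (hpos 1 (by norm_num)).le (pow_nonneg h0 1)
    have h2 := mul_nonneg (hpos 2 (by norm_num)).le (pow_nonneg h0 2)
    have h3 := mul_nonneg (hpos 3 (by norm_num)).le (pow_nonneg h0 3)
    have h4 := hpos 0 (by norm_num)
    simp only [pow_zero, mul_one] at hev
    linarith
  have hx : x < 0 := hneg x (by simp [hr])
  have hy : y < 0 := hneg y (by simp [hr])
  have hz : z < 0 := hneg z (by simp [hr])
  have hl : g.leadingCoeff = g.coeff 3 := by rw [leadingCoeff, hd]
  set c := g.coeff 3 with hc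
  have hc0 : 0 < c := hpos 3 le_rfl
  have hgeq : g = C c * X ^ 3 + C (c * -(x + y + z)) * X ^ 2 +
      C (c * (x * y + y * z + z * x)) * X + C (c * -(x * y * z)) := by
    have := hg.eq_prod_roots
    rw [hr, hl] at this
    simp only [Multiset.insert_eq_cons, Multiset.map_cons, Multiset.map_singleton,
      Multiset.prod_cons, Multiset.prod_singleton] at this
    rw [this]
    simp only [map_add, map_mul, map_neg]
    ring
  have e2 : g.coeff 2 = c * -(x + y + z) := by
    rw [hgeq]; simp only [coeff_add, coeff_C_mul, coeff_X_pow, coeff_X, coeff_C]; norm_num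
  have e1 : g.coeff 1 = c * (x * y + y * z + z * x) := by
    rw [hgeq]; simp only [coeff_add, coeff_C_mul, coeff_X_pow, coeff_X, coeff_C]; norm_num
  have e0 : g.coeff 0 = c * -(x * y * z) := by
    rw [hgeq]; simp
  have hx' := hx.ne
  have hy' := hy.ne
  have hz' := hz.ne
  have hcn := hc0.ne'
  have r1 : g.coeff 1 / g.coeff 0 = -x⁻¹ + -y⁻¹ + -z⁻¹ := by
    rw [e1, e0]; field_simp; ring
  have r2 : g.coeff 2 / g.coeff 0 =
      (-x⁻¹) * (-y⁻¹) + (-y⁻¹) * (-z⁻¹) + (-z⁻¹) * (-x⁻¹) := by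
    rw [e2, e0]; field_simp; ring
  have r3 : c / g.coeff 0 = (-x⁻¹) * (-y⁻¹) * (-z⁻¹) := by
    rw [e0]; field_simp
  rw [r1, r2, r3]
  have ix : 0 ≤ -x⁻¹ := (neg_pos.2 (inv_lt_zero.2 hx)).le
  have iy : 0 ≤ -y⁻¹ := (neg_pos.2 (inv_lt_zero.2 hy)).le
  have iz : 0 ≤ -z⁻¹ := (neg_pos.2 (inv_lt_zero.2 hz)).le
  refine ⟨?_, schur_inequality ix iy iz⟩
  nlinarith [sq_nonneg (-x⁻¹ - -y⁻¹), sq_nonneg (-y⁻¹ - -z⁻¹), sq_nonneg (-z⁻¹ - -x⁻¹)]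

theorem fourteen_mul_le {t u v w : ℝ} (ht : 0 < t) (hu : 0 < u) (hle : t * u ≤ 5)
    (hnewton : 3 * v ≤ u ^ 2) (hschur : u * (4 * v - u ^ 2) ≤ 9 * w) :
    14 * (t ^ 2 * v) ≤ 21 * (t * u) + 3 * (t ^ 3 * w) := by
  have h1 : 3 * (t ^ 2 * v) ≤ (t * u) ^ 2 := by
    nlinarith [mul_le_mul_of_nonneg_left hnewton (pow_pos ht 2).le]
  have h2 : t * u * (4 * (t ^ 2 * v) - (t * u) ^ 2) ≤ 9 * (t ^ 3 * w) := by
    nlinarith [mul_le_mul_of_nonneg_left hschur (pow_pos ht 3).le]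
  have hx : 0 < t * u := mul_pos ht hu
  generalize t * u = x at *
  nlinarith [mul_nonneg (show 0 ≤ 42 - 4 * x by linarith) (sub_nonneg.2 h1),
    mul_nonneg hx.le (mul_nonneg (sub_nonneg.2 hle) (show 0 ≤ 37 - x by linarith))]

theorem ten_mul_le {t u v w : ℝ} (ht : 0 < t) (hu : 0 < u) (hle : t * u ≤ 9 / 5)
    (hnewton : 3 * v ≤ u ^ 2) (hschur : u * (4 * v - u ^ 2) ≤ 9 * w) :
    10 * (t ^ 2 * v) ≤ 5 * (t * u) + 9 * (t ^ 3 * w) := by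
  have h1 : 3 * (t ^ 2 * v) ≤ (t * u) ^ 2 := by
    nlinarith [mul_le_mul_of_nonneg_left hnewton (pow_pos ht 2).le]
  have h2 : t * u * (4 * (t ^ 2 * v) - (t * u) ^ 2) ≤ 9 * (t ^ 3 * w) := by
    nlinarith [mul_le_mul_of_nonneg_left hschur (pow_pos ht 3).le]
  have hx : 0 < t * u := mul_pos ht hu
  generalize t * u = x at *
  nlinarith [mul_nonneg (show 0 ≤ 10 - 4 * x by linarith) (sub_nonneg.2 h1),
    mul_nonneg hx.le (mul_nonneg (sub_nonneg.2 hle) (show 0 ≤ 41 / 5 - x by linarith))]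

theorem coeff_prod_X_sub_C_pos (s : Multiset ℝ) (hs : ∀ r ∈ s, r < 0) :
    ∀ k ≤ s.card, 0 < (s.map fun a => X - C a).prod.coeff k := by
  induction s using Multiset.induction with
  | empty => simp
  | cons a s ih =>
    have ih' := ih fun r hr => hs r (Multiset.mem_cons_of_mem hr)
    have ha := hs a (Multiset.mem_cons_self a s)
    intro k hk
    rw [Multiset.card_cons] at hk
    have hd : (s.map fun a => X - C a).prod.natDegree = s.card :=
      natDegree_multiset_prod_X_sub_C_eq_card s
    rw [Multiset.map_cons, Multiset.prod_cons, sub_mul]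
    cases k with
    | zero =>
      have := ih' 0 (Nat.zero_le _)
      simp only [coeff_sub, coeff_X_mul_zero, coeff_C_mul]
      nlinarith
    | succ k =>
      have h1 := ih' k (by omega)
      simp only [coeff_sub, coeff_X_mul, coeff_C_mul]
      rcases Nat.lt_or_ge s.card (k + 1) with h | h
      · rw [coeff_eq_zero_of_natDegree_lt (n := k + 1) (by omega)]
        simpa using h1
      · have := ih' (k + 1) h
        nlinarith

/-- In a real-rooted septic with positive coefficients, the inequality
`e₂ - 2 * b * e₁ + b ^ 2 < 0` forces `e₃ < b * e₂`, where `eₖ` is the coefficient of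
`X ^ (7 - k)`. -/
theorem coeff_four_lt {f : ℝ[X]} (hf : f.Splits) (hm : f.Monic) (hd : f.natDegree = 7)
    (hpos : ∀ k ≤ 7, 0 < f.coeff k) {b : ℝ} (hb : 0 < b)
    (h : f.coeff 5 + b ^ 2 < 2 * b * f.coeff 6) : f.coeff 4 < b * f.coeff 5 := by
  by_contra! hcon
  have h7 : f.coeff 7 = 1 := by rw [← hd]; exact hm
  obtain ⟨h1, h2⟩ := cubic_coeff_inequalities
    (splits_derivative (splits_derivative (splits_derivative (splits_derivative hf))))
    (by simp [natDegree_derivative, hd]) (by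
      intro k hk
      simp only [coeff_derivative]
      have := hpos (k + 1 + 1 + 1 + 1) (by omega)
      positivity)
  simp only [coeff_derivative] at h1 h2
  norm_num [h7] at h1 h2
  have p4 := hpos 4 (by norm_num)
  have p5 := hpos 5 (by norm_num)
  have p6 := hpos 6 (by norm_num)
  generalize f.coeff 4 = e3 at *
  generalize f.coeff 5 = e2 at *
  generalize f.coeff 6 = e1 at *
  have key := fourteen_mul_le (t := b) hb (by positivity) (by
    rw [← mul_div_assoc, div_le_iff₀ (by positivity)]
    linarith) h1 h2
  have hmul : b ^ 2 * (e2 + b ^ 2) * (105 / (b * e3)) < b ^ 2 * (2 * b * e1) * (105 / (b * e3)) := by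
    gcongr
  apply hmul.not_ge
  convert! key using 1 <;> field_simp <;> ring

/-- In a real-rooted septic with positive coefficients, the inequality
`e₅ - 2 * b * e₄ + b ^ 2 * e₃ < 0` forces `b * e₂ < e₃`, where `eₖ` is the coefficient of
`X ^ (7 - k)`. -/
theorem lt_coeff_four {f : ℝ[X]} (hf : f.Splits) (hd : f.natDegree = 7)
    (hpos : ∀ k ≤ 7, 0 < f.coeff k) {b : ℝ} (hb : 0 < b)
    (h : f.coeff 2 + b ^ 2 * f.coeff 4 < 2 * b * f.coeff 3) : b * f.coeff 5 < f.coeff 4 := by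
  by_contra! hcon
  have hq : (derivative (derivative f)).natDegree = 5 := by simp [natDegree_derivative, hd]
  have hr : (derivative (derivative f)).reverse.natDegree = 5 := by
    rw [reverse_natDegree, hq, natTrailingDegree_eq_zero_of_constantCoeff_ne_zero]
    have := hpos 2 (by norm_num)
    simp [coeff_derivative, this.ne']
  have hco : ∀ k ≤ 5, (derivative (derivative f)).reverse.coeff k =
      (derivative (derivative f)).coeff (5 - k) := by
    intro k hk
    rw [coeff_reverse, hq, revAt_le hk]
  obtain ⟨h1, h2⟩ := cubic_coeff_inequalities
    (splits_derivative (splits_derivative (splits_reverse (splits_derivative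
      (splits_derivative hf)))))
    (by simp [natDegree_derivative, hr]) (by
      intro k hk
      rw [coeff_derivative, coeff_derivative, hco _ (by omega), coeff_derivative,
        coeff_derivative]
      have := hpos (5 - (k + 1 + 1) + 1 + 1) (by omega)
      positivity)
  simp only [coeff_derivative, Nat.reduceAdd, zero_add] at h1 h2
  rw [hco 2 (by norm_num), hco 3 (by norm_num), hco 4 (by norm_num)] at h1
  rw [hco 2 (by norm_num), hco 3 (by norm_num), hco 4 (by norm_num), hco 5 le_rfl] at h2
  simp only [coeff_derivative] at h1 h2
  norm_num at h1 h2
  have p2 := hpos 2 (by norm_num)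
  have p3 := hpos 3 (by norm_num)
  have p4 := hpos 4 (by norm_num)
  have p5 := hpos 5 (by norm_num)
  generalize f.coeff 4 = e3 at *
  generalize f.coeff 5 = e2 at *
  generalize f.coeff 3 = e4 at *
  generalize f.coeff 2 = e5 at *
  have key := ten_mul_le (t := b⁻¹) (inv_pos.2 hb) (by positivity) (by
    rw [inv_mul_le_iff₀ hb, div_le_iff₀ (by positivity)]
    linarith) h1 h2
  have hmul : (e5 + b ^ 2 * e3) * (9 / (b ^ 3 * e2)) < (2 * b * e4) * (9 / (b ^ 3 * e2)) := by
    gcongr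
  apply hmul.not_ge
  convert! key using 1 <;> field_simp <;> ring

/-- For `d = 9`, the sign pattern `Σ_{2,4,4}` is not realizable with the pair
`(0, 7)`. -/
theorem stmt9 :
    ¬ ∃ P : Polynomial ℝ, P.Monic ∧ P.natDegree = 9 ∧
      0 < P.coeff 9 ∧ 0 < P.coeff 8 ∧
      P.coeff 7 < 0 ∧ P.coeff 6 < 0 ∧ P.coeff 5 < 0 ∧ P.coeff 4 < 0 ∧
      0 < P.coeff 3 ∧ 0 < P.coeff 2 ∧ 0 < P.coeff 1 ∧ 0 < P.coeff 0 ∧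
      realizesPair P 0 7 := by
  rintro ⟨P, hP, hdeg, -, -, h7, -, -, h4, -, -, -, -, -, hp, hn, h0⟩
  have hneg : ∀ r ∈ P.roots, r < 0 := by
    intro r hr
    rw [Multiset.card_eq_zero, Multiset.filter_eq_nil] at hp
    exact lt_of_le_of_ne (not_lt.1 (hp r hr)) fun h => h0 (h ▸ hr)
  rw [Multiset.filter_eq_self.2 hneg] at hn
  obtain ⟨q, hfq, hcard, hq⟩ := exists_prod_multiset_X_sub_C_mul P
  have hpos := coeff_prod_X_sub_C_pos P.roots hneg
  have hfd : (P.roots.map fun a => X - C a).prod.natDegree = P.roots.card :=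
    natDegree_multiset_prod_X_sub_C_eq_card _
  have hfm : (P.roots.map fun a => X - C a).prod.Monic := monic_multiset_prod_of_monic _ _
    fun a _ => monic_X_sub_C a
  have hfs : (P.roots.map fun a => X - C a).prod.Splits := Splits.multisetProd (by
    intro g hg
    obtain ⟨a, -, rfl⟩ := Multiset.mem_map.1 hg
    exact Splits.X_sub_C a)
  rw [hn] at hpos hfd
  generalize (P.roots.map fun a => X - C a).prod = f at *
  have hqm : q.Monic := hfm.of_mul_monic_left (hfq ▸ hP)
  have hqd : q.natDegree = 2 := by omega
  have hq2 : q.coeff 2 = 1 := by rw [← hqd]; exact hqm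
  have hqeq : q = X ^ 2 + C (q.coeff 1) * X + C (q.coeff 0) := by
    conv_lhs => rw [q.as_sum_range_C_mul_X_pow, hqd]
    simp only [Finset.sum_range_succ, Finset.sum_range_zero, hq2]
    simp
    ring
  generalize q.coeff 1 = c at hqeq
  generalize q.coeff 0 = d at hqeq
  have hdisc : c ^ 2 < 4 * d := by
    by_contra! hcon
    have : (-c + √(c ^ 2 - 4 * d)) / 2 ∈ q.roots := by
      rw [mem_roots hqm.ne_zero, IsRoot.def, hqeq]
      have := Real.sq_sqrt (sub_nonneg.2 hcon)
      simp only [eval_add, eval_mul, eval_pow, eval_X, eval_C]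
      linear_combination this / 4
    simp [hq] at this
  have hd0 : 0 < d := by nlinarith [sq_nonneg c]
  have hb : 0 < √d := Real.sqrt_pos.2 hd0
  have hbd : √d ^ 2 = d := Real.sq_sqrt hd0.le
  have hc : -c < 2 * √d := by
    apply lt_of_pow_lt_pow_left₀ 2 (by positivity)
    nlinarith
  have hcoeff : ∀ k, P.coeff (k + 2) = f.coeff k + c * f.coeff (k + 1) + d * f.coeff (k + 2) := by
    intro k
    have : P = f * X ^ 2 + C c * (f * X) + C d * f := by rw [← hfq, hqeq]; ring
    rw [this]
    simp only [coeff_add, coeff_C_mul, coeff_mul_X_pow]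
    rw [show k + 2 = (k + 1) + 1 from rfl, coeff_mul_X]
  have hf7 : f.coeff 7 = 1 := by rw [← hfd]; exact hfm
  have k7 := hcoeff 5
  have k4 := hcoeff 2
  norm_num [hf7] at k7 k4
  have h6 := hpos 6 (by norm_num)
  have h3 := hpos 3 (by norm_num)
  have hlt := coeff_four_lt hfs hfm hfd hpos hb (by rw [hbd]; nlinarith)
  have hgt := lt_coeff_four hfs hfd hpos hb (by rw [hbd]; nlinarith)
  exact lt_asymm hlt hgt
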